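/- arXiv:2601.01703 — 3 statements merged into one kernel-verified Lean document; each statement's English description precedes it below -/
import Mathlib

section
/- Let (u,v) be an edge of G such that (Â² − Â)_{uv} > 0, and set T(u,v) = 1 − 1/d̂_u − 1/d̂_v. Then the number of common neighbors of u and v satisfies |CN(u,v)| ≥ ⌊3·T(u,v)⌋ + 1. -/
open Finset

/-- Augmented degree `d̂_u = d_u + 1` as a real number. -/
noncomputable def dhat {V : Type*} [Fintype V] (G : SimpleGraph V) [DecidableRel G.Adj]
    (u : V) : ℝ :=
  (G.degree u : ℝ) + 1

/-- Self-loop-augmented normalized adjacency `Â_{uv} = (A + I)_{uv} / √(d̂_u d̂_v)`. -/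
noncomputable def Ahat {V : Type*} [Fintype V] [DecidableEq V] (G : SimpleGraph V)
    [DecidableRel G.Adj] : Matrix V V ℝ :=
  Matrix.of fun u v => (G.adjMatrix ℝ + 1) u v / Real.sqrt (dhat G u * dhat G v)

lemma dhat_pos {V : Type*} [Fintype V] (G : SimpleGraph V) [DecidableRel G.Adj] (u : V) :
    0 < dhat G u := by
  unfold dhat
  positivity

/-- A common neighbor of two adjacent vertices has augmented degree at least three. -/
lemma three_le_dhat_of_common_neighbor {V : Type*} [Fintype V] [DecidableEq V]
    (G : SimpleGraph V) [DecidableRel G.Adj] {u v w : V} (huv : G.Adj u v)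
    (huw : G.Adj u w) (hvw : G.Adj v w) : 3 ≤ dhat G w := by
  have hsub : ({u, v} : Finset V) ⊆ G.neighborFinset w := by
    intro x hx
    rcases Finset.mem_insert.1 hx with rfl | hx
    · simpa using huw.symm
    · rw [Finset.mem_singleton.1 hx]
      simpa using hvw.symm
  have hcard := Finset.card_le_card hsub
  rw [Finset.card_pair huv.ne, G.card_neighborFinset_eq_degree] at hcard
  have hdeg : (2 : ℝ) ≤ G.degree w := by exact_mod_cast hcard
  unfold dhat
  linarith

/-- The products defining `Â²` share the factor `1 / √(d̂_u d̂_v)`. -/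
lemma Ahat_mul_Ahat {V : Type*} [Fintype V] [DecidableEq V] (G : SimpleGraph V)
    [DecidableRel G.Adj] (u w v : V) :
    Ahat G u w * Ahat G w v =
      (G.adjMatrix ℝ + 1) u w * (G.adjMatrix ℝ + 1) w v / dhat G w /
        Real.sqrt (dhat G u * dhat G v) := by
  have hu := dhat_pos G u
  have hw := dhat_pos G w
  have hsqrt : Real.sqrt (dhat G u * dhat G w) * Real.sqrt (dhat G w * dhat G v) =
      dhat G w * Real.sqrt (dhat G u * dhat G v) := by
    rw [← Real.sqrt_mul (by positivity),
      show dhat G u * dhat G w * (dhat G w * dhat G v) =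
        dhat G w ^ 2 * (dhat G u * dhat G v) by ring,
      Real.sqrt_mul (by positivity), Real.sqrt_sq hw.le]
  simp only [Ahat, Matrix.of_apply]
  rw [div_mul_div_comm, hsqrt, div_div]

/-- Each two-step path between adjacent vertices is a self-loop at one end followed or preceded
by the edge, or passes through a common neighbor. -/
lemma two_step_weight_le {V : Type*} [Fintype V] [DecidableEq V] (G : SimpleGraph V)
    [DecidableRel G.Adj] {u v : V} (huv : G.Adj u v) (w : V) :
    (G.adjMatrix ℝ + 1) u w * (G.adjMatrix ℝ + 1) w v / dhat G w ≤
      (if w = u then 1 / dhat G u else 0) + (if w = v then 1 / dhat G v else 0) +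
        (if w ∈ G.commonNeighbors u v then 1 / 3 else 0) := by
  by_cases hwu : w = u
  · subst hwu
    simp [huv, huv.ne, SimpleGraph.mem_commonNeighbors]
  by_cases hwv : w = v
  · subst hwv
    simp [huv, huv.ne, huv.ne', SimpleGraph.mem_commonNeighbors]
  by_cases hcn : w ∈ G.commonNeighbors u v
  · have hadj := G.mem_commonNeighbors.1 hcn
    have hthree := three_le_dhat_of_common_neighbor G huv hadj.1 hadj.2
    simp only [hwu, hwv, hcn, Matrix.add_apply, SimpleGraph.adjMatrix_apply, hadj.1,
      hadj.2.symm, Matrix.one_apply, Ne.symm hwu, if_true, if_false, add_zero, zero_add, mul_one]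
    exact one_div_le_one_div_of_le (by norm_num) hthree
  · have hnot : ¬ (G.Adj u w ∧ G.Adj w v) := fun h =>
      hcn (G.mem_commonNeighbors.2 ⟨h.1, h.2.symm⟩)
    by_cases h : G.Adj u w
    · have h2 : ¬ G.Adj w v := fun h2 => hnot ⟨h, h2⟩
      simp [hwu, hwv, hcn, h2]
    · simp [hwu, hwv, hcn, h, Ne.symm hwu]

/-- If `(Â² − Â)_{uv} > 0` for an edge `(u,v)`, then the number of common neighbors
of `u` and `v` satisfies `|CN(u,v)| ≥ ⌊3 T(u,v)⌋ + 1` where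
`T(u,v) = 1 − 1/d̂_u − 1/d̂_v`. -/
theorem triangle_support_lower_bound {V : Type*} [Fintype V] [DecidableEq V]
    (G : SimpleGraph V) [DecidableRel G.Adj] (u v : V) (huv : G.Adj u v)
    (hpos : 0 < (Ahat G ^ 2 - Ahat G) u v) :
    ⌊3 * (1 - 1 / dhat G u - 1 / dhat G v)⌋ + 1 ≤
      (Fintype.card (G.commonNeighbors u v) : ℤ) := by
  set s := Real.sqrt (dhat G u * dhat G v) with hs
  have hspos : 0 < s := Real.sqrt_pos.2 (mul_pos (dhat_pos G u) (dhat_pos G v))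
  have hentry : Ahat G u v = 1 / s := by
    simp [Ahat, huv, huv.ne, hs]
  have hsquare : (Ahat G ^ 2) u v =
      (∑ w, (G.adjMatrix ℝ + 1) u w * (G.adjMatrix ℝ + 1) w v / dhat G w) / s := by
    rw [pow_two, Matrix.mul_apply, Finset.sum_div]
    exact Finset.sum_congr rfl fun w _ => Ahat_mul_Ahat G u w v
  have hone : 1 < ∑ w, (G.adjMatrix ℝ + 1) u w * (G.adjMatrix ℝ + 1) w v / dhat G w := by
    rw [Matrix.sub_apply, hsquare, hentry, sub_pos] at hpos
    exact (div_lt_div_iff_of_pos_right hspos).1 hpos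
  have hle := Finset.sum_le_sum fun w (_ : w ∈ Finset.univ) => two_step_weight_le G huv w
  have hcn : ∑ w, (if w ∈ G.commonNeighbors u v then (1 / 3 : ℝ) else 0) =
      (Fintype.card (G.commonNeighbors u v) : ℝ) / 3 := by
    rw [← Finset.sum_filter, Finset.sum_const, nsmul_eq_mul, ← Set.toFinset_card,
      ← Set.filter_mem_univ_eq_toFinset]
    ring
  rw [Finset.sum_add_distrib, Finset.sum_add_distrib, hcn] at hle
  simp only [Finset.sum_ite_eq', Finset.mem_univ, if_true] at hle
  rw [Int.add_one_le_iff, Int.floor_lt]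
  push_cast
  linarith
end

section
/- Let p_1, …, p_c ∈ H with ‖p_j‖ ≤ P for all j, let r ∈ H, β_c > 0, γ > 0, and let z ∈ {1,…,c} satisfy ⟨r, p_z⟩ ≥ ⟨r, p_j⟩ + γ for every j ≠ z. Define w = Σ_{j=1}^{c} α_j p_j, where α_j = exp(β_c ⟨r, p_j⟩) / Σ_{k=1}^{c} exp(β_c ⟨r, p_k⟩). Then ‖w − p_z‖ ≤ 2P (c − 1) e^{−β_c γ}. -/
open Finset
open scoped RealInnerProductSpace

/-- Softmax weights with temperature `β` on a score vector `s : Fin c → ℝ`. -/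
noncomputable def softmax {c : ℕ} (β : ℝ) (s : Fin c → ℝ) (j : Fin c) : ℝ :=
  Real.exp (β * s j) / ∑ k, Real.exp (β * s k)

theorem sum_softmax {c : ℕ} [NeZero c] (β : ℝ) (s : Fin c → ℝ) : ∑ j, softmax β s j = 1 := by
  have hpos : 0 < ∑ k, Real.exp (β * s k) :=
    Finset.sum_pos (fun k _ => Real.exp_pos _) Finset.univ_nonempty
  simp only [softmax, ← Finset.sum_div]
  exact div_self hpos.ne'

theorem softmax_nonneg {c : ℕ} (β : ℝ) (s : Fin c → ℝ) (j : Fin c) : 0 ≤ softmax β s j := by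
  unfold softmax
  positivity

theorem softmax_le_exp_sub {c : ℕ} (β : ℝ) (s : Fin c → ℝ) (j z : Fin c) :
    softmax β s j ≤ Real.exp (β * (s j - s z)) := by
  have hle : Real.exp (β * s z) ≤ ∑ k, Real.exp (β * s k) :=
    Finset.single_le_sum (f := fun k => Real.exp (β * s k))
      (fun k _ => (Real.exp_pos _).le) (Finset.mem_univ z)
  rw [mul_sub, Real.exp_sub]
  unfold softmax
  gcongr

/-- If `⟨r, p_z⟩ ≥ ⟨r, p_j⟩ + γ` for all `j ≠ z`, then the prototype-attention output
`w = Σ_j α_j p_j` (softmax weights with temperature `β_c` on scores `⟨r, p_j⟩`)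
satisfies `‖w − p_z‖ ≤ 2 P (c − 1) e^{−β_c γ}`. -/
theorem prototype_attention_close_to_true_prototype {H : Type*} [NormedAddCommGroup H]
    [InnerProductSpace ℝ H] {c : ℕ} (p : Fin c → H) (P : ℝ) (hp : ∀ j, ‖p j‖ ≤ P)
    (r : H) (βc γ : ℝ) (hβc : 0 < βc) (hγ : 0 < γ) (z : Fin c)
    (hmargin : ∀ j, j ≠ z → ⟪r, p j⟫ + γ ≤ ⟪r, p z⟫) :
    ‖(∑ j, softmax βc (fun k => ⟪r, p k⟫) j • p j) - p z‖ ≤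
      2 * P * ((c : ℝ) - 1) * Real.exp (-(βc * γ)) := by
  have : NeZero c := ⟨fun h => (h ▸ z).elim0⟩
  set s : Fin c → ℝ := fun k => ⟪r, p k⟫ with hs
  have hdiff : (∑ j, softmax βc s j • p j) - p z =
      ∑ j ∈ univ.erase z, softmax βc s j • (p j - p z) := by
    rw [Finset.sum_erase _ (by simp)]
    simp only [smul_sub, Finset.sum_sub_distrib, ← Finset.sum_smul, sum_softmax, one_smul]
  have hterm : ∀ j ∈ univ.erase z,
      ‖softmax βc s j • (p j - p z)‖ ≤ Real.exp (-(βc * γ)) * (2 * P) := by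
    intro j hj
    have hm := hmargin j (Finset.ne_of_mem_erase hj)
    have hweight : softmax βc s j ≤ Real.exp (-(βc * γ)) := by
      refine (softmax_le_exp_sub βc s j z).trans (Real.exp_le_exp.mpr ?_)
      rw [← mul_neg]
      exact mul_le_mul_of_nonneg_left (by simp only [hs]; linarith) hβc.le
    have hnorm : ‖p j - p z‖ ≤ 2 * P := by
      linarith [norm_sub_le (p j) (p z), hp j, hp z]
    rw [norm_smul, Real.norm_of_nonneg (softmax_nonneg _ _ _)]
    exact mul_le_mul hweight hnorm (norm_nonneg _) (Real.exp_pos _).le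
  rw [hdiff]
  refine (norm_sum_le_of_le _ hterm).trans_eq ?_
  rw [Finset.sum_const, Finset.card_erase_of_mem (Finset.mem_univ z), Finset.card_univ,
    Fintype.card_fin, nsmul_eq_mul, Nat.cast_pred (NeZero.pos c)]
  ring
end

section
/- Define the hard-masked hop channels by Â^{(0)} = I, Â^{(1)} = Â, and for k ≥ 2, Â^{(k)}_{ij} = (Â^k)_{ij} if (Σ_{l=1}^{k−1} Â^{(l)})_{ij} = 0 and Â^{(k)}_{ij} = 0 otherwise. Then for every k ≥ 2 and all vertices i, j: Â^{(k)}_{ij} ≠ 0 if and only if the shortest-path distance between i and j in G equals k (i.e., the shortest walk from i to j has length exactly k). -/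
open Finset

/-- Hard-masked hop channels: `Â⁽⁰⁾ = I`, `Â⁽¹⁾ = Â`, and for `k ≥ 2`,
`Â⁽ᵏ⁾_{ij} = (Âᵏ)_{ij}` if `(Σ_{l=1}^{k−1} Â⁽ˡ⁾)_{ij} = 0`, else `0`. -/
noncomputable def hopChannel {V : Type*} [Fintype V] [DecidableEq V]
    (A : Matrix V V ℝ) : ℕ → Matrix V V ℝ
  | 0 => 1
  | 1 => A
  | (k + 2) =>
      Matrix.of fun i j =>
        if (∑ l ∈ (Finset.Icc 1 (k + 1)).attach, hopChannel A l.1) i j = 0 then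
          (A ^ (k + 2)) i j
        else 0
  decreasing_by
    all_goals
      have hl := l.2
      simp only [Finset.mem_Icc] at hl
      omega

theorem hopChannel_add_two_apply {V : Type*} [Fintype V] [DecidableEq V] (A : Matrix V V ℝ)
    (k : ℕ) (i j : V) :
    hopChannel A (k + 2) i j =
      if ∑ l ∈ Finset.Icc 1 (k + 1), hopChannel A l i j = 0 then (A ^ (k + 2)) i j else 0 := by
  rw [hopChannel, Matrix.of_apply, Finset.sum_attach _ (hopChannel A), Matrix.sum_apply]

theorem hopChannel_eq_zero_or_eq_pow {V : Type*} [Fintype V] [DecidableEq V] (A : Matrix V V ℝ)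
    (k : ℕ) (i j : V) : hopChannel A k i j = 0 ∨ hopChannel A k i j = (A ^ k) i j := by
  match k with
  | 0 => right; rw [hopChannel, pow_zero]
  | 1 => right; rw [hopChannel, pow_one]
  | k + 2 =>
    rw [hopChannel_add_two_apply]
    split_ifs <;> simp

theorem hopChannel_nonneg {V : Type*} [Fintype V] [DecidableEq V] {A : Matrix V V ℝ}
    (hA : ∀ (k : ℕ) (i j : V), 0 ≤ (A ^ k) i j) (k : ℕ) (i j : V) : 0 ≤ hopChannel A k i j := by
  rcases hopChannel_eq_zero_or_eq_pow A k i j with h | h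
  · exact h.ge
  · exact h ▸ hA k i j

/-- For a matrix with nonnegative powers, a masked channel of order at least one is nonzero exactly
when its order is the first positive power with a nonzero entry. -/
theorem hopChannel_ne_zero_iff {V : Type*} [Fintype V] [DecidableEq V] {A : Matrix V V ℝ}
    (hA : ∀ (k : ℕ) (i j : V), 0 ≤ (A ^ k) i j) {k : ℕ} (hk : 1 ≤ k) (i j : V) :
    hopChannel A k i j ≠ 0 ↔ (A ^ k) i j ≠ 0 ∧ ∀ l, 1 ≤ l → l < k → (A ^ l) i j = 0 := by
  induction k using Nat.strong_induction_on with
  | _ k ih =>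
    match k, hk with
    | 1, _ =>
      rw [hopChannel, pow_one]
      exact ⟨fun h => ⟨h, fun l h₁ h₂ => by omega⟩, And.left⟩
    | k + 2, _ =>
      have hsum : ∑ l ∈ Finset.Icc 1 (k + 1), hopChannel A l i j = 0 ↔
          ∀ l, 1 ≤ l → l < k + 2 → (A ^ l) i j = 0 := by
        rw [Finset.sum_eq_zero_iff_of_nonneg fun l _ => hopChannel_nonneg hA l i j]
        constructor
        · intro h l
          induction l using Nat.strong_induction_on with
          | _ l ihl =>
            intro h₁ h₂
            by_contra hne
            exact (ih l h₂ h₁).2 ⟨hne, fun m hm hml => ihl m hml hm (hml.trans h₂)⟩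
              (h l (Finset.mem_Icc.2 ⟨h₁, by omega⟩))
        · intro h l hl
          rw [Finset.mem_Icc] at hl
          rcases hopChannel_eq_zero_or_eq_pow A l i j with h' | h'
          · exact h'
          · rw [h', h l hl.1 (by omega)]
      rw [hopChannel_add_two_apply, ite_ne_right_iff, hsum, and_comm]

theorem Ahat_nonneg {V : Type*} [Fintype V] [DecidableEq V] (G : SimpleGraph V)
    [DecidableRel G.Adj] (i j : V) : 0 ≤ Ahat G i j := by
  simp only [Ahat, Matrix.of_apply, Matrix.add_apply, SimpleGraph.adjMatrix_apply, Matrix.one_apply]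
  positivity

theorem Ahat_ne_zero_iff {V : Type*} [Fintype V] [DecidableEq V] (G : SimpleGraph V)
    [DecidableRel G.Adj] (i j : V) : Ahat G i j ≠ 0 ↔ i = j ∨ G.Adj i j := by
  have hpos : 0 < Real.sqrt (dhat G i * dhat G j) := by
    unfold dhat
    positivity
  simp only [Ahat, Matrix.of_apply, Matrix.add_apply, SimpleGraph.adjMatrix_apply,
    Matrix.one_apply, ne_eq, div_eq_zero_iff, hpos.ne', or_false]
  by_cases h : i = j <;> by_cases h' : G.Adj i j <;> simp [h, h']

theorem Ahat_pow_nonneg {V : Type*} [Fintype V] [DecidableEq V] (G : SimpleGraph V)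
    [DecidableRel G.Adj] (k : ℕ) (i j : V) : 0 ≤ (Ahat G ^ k) i j := by
  induction k generalizing i with
  | zero => rw [pow_zero, Matrix.one_apply]; positivity
  | succ k ih =>
    rw [pow_succ', Matrix.mul_apply]
    exact Finset.sum_nonneg fun m _ => mul_nonneg (Ahat_nonneg G i m) (ih m)

theorem Ahat_pow_ne_zero_iff_exists_walk {V : Type*} [Fintype V] [DecidableEq V]
    (G : SimpleGraph V) [DecidableRel G.Adj] (k : ℕ) (i j : V) :
    (Ahat G ^ k) i j ≠ 0 ↔ ∃ p : G.Walk i j, p.length ≤ k := by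
  induction k generalizing i with
  | zero =>
    rw [pow_zero, Matrix.one_apply, ite_ne_right_iff]
    constructor
    · rintro ⟨rfl, -⟩
      exact ⟨.nil, le_rfl⟩
    · rintro ⟨p, hp⟩
      exact ⟨SimpleGraph.Walk.eq_of_length_eq_zero (Nat.le_zero.1 hp), one_ne_zero⟩
  | succ k ih =>
    rw [pow_succ', Matrix.mul_apply, ne_eq, Finset.sum_eq_zero_iff_of_nonneg fun m _ =>
      mul_nonneg (Ahat_nonneg G i m) (Ahat_pow_nonneg G k m j)]
    simp only [Finset.mem_univ, true_imp_iff, not_forall, ← ne_eq, mul_ne_zero_iff,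
      Ahat_ne_zero_iff, ih]
    constructor
    · rintro ⟨m, rfl | h, p, hp⟩
      · exact ⟨p, hp.trans k.le_succ⟩
      · exact ⟨.cons h p, Nat.succ_le_succ hp⟩
    · rintro ⟨p, hp⟩
      cases p with
      | nil => exact ⟨_, .inl rfl, .nil, k.zero_le⟩
      | cons h p => exact ⟨_, .inr h, p, Nat.le_of_succ_le_succ hp⟩

theorem Ahat_pow_ne_zero_iff {V : Type*} [Fintype V] [DecidableEq V] (G : SimpleGraph V)
    [DecidableRel G.Adj] (k : ℕ) (i j : V) :
    (Ahat G ^ k) i j ≠ 0 ↔ G.Reachable i j ∧ G.dist i j ≤ k := by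
  rw [Ahat_pow_ne_zero_iff_exists_walk]
  constructor
  · rintro ⟨p, hp⟩
    exact ⟨p.reachable, (SimpleGraph.dist_le p).trans hp⟩
  · rintro ⟨h, hk⟩
    obtain ⟨p, hp⟩ := h.exists_walk_length_eq_dist
    exact ⟨p, hp.trans_le hk⟩

/-- For `k ≥ 2`, the hard-masked hop channel entry `Â⁽ᵏ⁾_{ij}` is nonzero iff the
shortest-path distance between `i` and `j` in `G` equals `k`. -/
theorem hopChannel_ne_zero_iff_dist_eq {V : Type*} [Fintype V] [DecidableEq V]
    (G : SimpleGraph V) [DecidableRel G.Adj] (k : ℕ) (hk : 2 ≤ k) (i j : V) :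
    hopChannel (Ahat G) k i j ≠ 0 ↔ G.Reachable i j ∧ G.dist i j = k := by
  rw [hopChannel_ne_zero_iff (Ahat_pow_nonneg G) (by omega), Ahat_pow_ne_zero_iff]
  constructor
  · rintro ⟨⟨hr, hd⟩, h⟩
    refine ⟨hr, le_antisymm hd ?_⟩
    by_contra! hlt
    exact (Ahat_pow_ne_zero_iff G (k - 1) i j).2 ⟨hr, by omega⟩ (h (k - 1) (by omega) (by omega))
  · rintro ⟨hr, rfl⟩
    refine ⟨⟨hr, le_rfl⟩, fun l _ hl => ?_⟩
    by_contra hne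
    exact hl.not_ge ((Ahat_pow_ne_zero_iff G l i j).1 hne).2
end
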